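/- Let A be a simple unital C*-algebra which admits a tracial state, such that every tracial state on A is faithful, and which has strict comparison of positive elements. Let p ∈ A be a nonzero projection and let a ∈ A be a positive element such that 0 is a non-isolated point of the spectrum σ(a). Then p ≾ a if and only if d_τ(p) < d_τ(a) for every tracial state τ on A. -/

import Mathlib

open Filter Topology

/-- Cuntz subequivalence: `a ≾ b` iff there is a sequence `xₙ` with `xₙ * b * xₙ* → a`
(equivalently, `‖xₙ * b * xₙ* - a‖ → 0` in a normed setting). -/
def CuntzLE {M : Type*} [Mul M] [Star M] [TopologicalSpace M] (a b : M) : Prop :=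
  ∃ x : ℕ → M, Tendsto (fun n => x n * b * star (x n)) atTop (𝓝 a)

/-- Cuntz equivalence: `a ∼ b` iff `a ≾ b` and `b ≾ a`. -/
def CuntzEquiv {M : Type*} [Mul M] [Star M] [TopologicalSpace M] (a b : M) : Prop :=
  CuntzLE a b ∧ CuntzLE b a

open scoped ComplexOrder in
/-- A tracial state on a unital C*-algebra: a positive linear functional taking the
value `1` at `1` and satisfying the trace identity. -/
def IsTracialState {A : Type*} [CStarAlgebra A] [PartialOrder A] (τ : A →ₗ[ℂ] ℂ) : Prop :=
  (∀ a : A, 0 ≤ a → 0 ≤ τ a) ∧ τ 1 = 1 ∧ ∀ x y : A, τ (x * y) = τ (y * x)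

/-- `dTr τ a = lim_n τ(a^{1/n})`, the dimension function associated to a trace `τ`,
evaluated at a positive element `a`. -/
noncomputable def dTr {A : Type*} [CStarAlgebra A] (τ : A → ℂ) (a : A) : ℝ :=
  limUnder atTop fun n : ℕ => (τ (cfc (fun t : ℝ => t ^ ((n : ℝ)⁻¹)) a)).re

/-- A C*-algebra has strict comparison of positive elements (with respect to tracial states)
if `d_τ(a) < d_τ(b)` for all tracial states `τ` implies `a ≾ b`, for nonzero positive `a, b`. -/
def StrictComparison (A : Type*) [CStarAlgebra A] [PartialOrder A] : Prop :=
  ∀ a b : A, 0 ≤ a → 0 ≤ b → a ≠ 0 → b ≠ 0 →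
    (∀ τ : A →ₗ[ℂ] ℂ, IsTracialState τ → dTr τ a < dTr τ b) → CuntzLE a b

/-- The cut-off `t ↦ min (t / δ) 1`. -/
noncomputable def ramp (δ t : ℝ) : ℝ := min (t / δ) 1

theorem continuous_ramp (δ : ℝ) : Continuous (ramp δ) := by
  unfold ramp; fun_prop

theorem ramp_le_rpow {δ t : ℝ} (hδ : 0 < δ) (ht : 0 ≤ t) {n : ℕ} (hn : n ≠ 0) :
    ramp δ t ≤ (δ⁻¹) ^ ((n : ℝ)⁻¹) * t ^ ((n : ℝ)⁻¹) := by
  rw [← Real.mul_rpow (by positivity) ht, ← div_eq_inv_mul]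
  have h0 : 0 ≤ t / δ := by positivity
  rcases le_total (t / δ) 1 with h | h
  · refine (min_le_left _ _).trans ?_
    have hn1 : (1 : ℝ) ≤ n := Nat.one_le_cast.mpr (Nat.one_le_iff_ne_zero.mpr hn)
    exact Real.self_le_rpow_of_le_one h0 h (inv_le_one_of_one_le₀ hn1)
  · exact (min_le_right _ _).trans (Real.one_le_rpow h (by positivity))

theorem continuous_rpow_inv_natCast {n : ℕ} :
    Continuous fun t : ℝ => t ^ ((n : ℝ)⁻¹) :=
  Real.continuous_rpow_const (by positivity)

theorem tendsto_rpow_inv_natCast {c : ℝ} (hc : 0 < c) :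
    Tendsto (fun n : ℕ => c ^ ((n : ℝ)⁻¹)) atTop (𝓝 1) := by
  have h := (Real.continuous_const_rpow hc.ne').tendsto 0
  rw [Real.rpow_zero] at h
  exact h.comp tendsto_inv_atTop_nhds_zero_nat

section

variable {A : Type*} [CStarAlgebra A]

theorem LinearMap.re_apply_real_smul (τ : A →ₗ[ℂ] ℂ) (r : ℝ) (x : A) :
    (τ (r • x)).re = r * (τ x).re := by
  have : r • x = (r : ℂ) • x := (Complex.coe_smul r x).symm
  rw [this, map_smul]
  simp

theorem dTr_eq_of_isStarProjection (τ : A →ₗ[ℂ] ℂ) {p : A} (hp : IsStarProjection p) :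
    dTr τ p = (τ p).re := by
  refine Tendsto.limUnder_eq (tendsto_const_nhds.congr' ?_)
  filter_upwards [eventually_ne_atTop 0] with n hn
  congr 2
  conv_lhs => rw [← cfc_id ℝ p hp.isSelfAdjoint]
  refine cfc_congr fun t ht => ?_
  have hn' : (n : ℝ)⁻¹ ≠ 0 := by positivity
  rcases hp.isIdempotentElem.spectrum_subset ℝ ht with rfl | rfl
  · simp [hn']
  · simp

variable [PartialOrder A] [StarOrderedRing A]

open scoped ComplexOrder

theorem IsTracialState.re_mono {τ : A →ₗ[ℂ] ℂ} (hτ : IsTracialState τ) {x y : A} (h : x ≤ y) :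
    (τ x).re ≤ (τ y).re := by
  have := hτ.1 (y - x) (sub_nonneg.mpr h)
  rw [map_sub] at this
  have := (Complex.le_def.mp this).1
  simpa using this

/-- The limit defining `dTr τ a` exists. -/
theorem IsTracialState.tendsto_dTr {τ : A →ₗ[ℂ] ℂ} (hτ : IsTracialState τ) {a : A} (ha : 0 ≤ a)
    (ha0 : a ≠ 0) :
    Tendsto (fun n : ℕ => (τ (cfc (fun t : ℝ => t ^ ((n : ℝ)⁻¹)) a)).re) atTop
      (𝓝 (dTr τ a)) := by
  apply tendsto_nhds_limUnder
  have hC : 0 < ‖a‖ := norm_pos_iff.mpr ha0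
  have : Nontrivial A := nontrivial_of_ne a 0 ha0
  set u : ℕ → ℝ := fun n => (τ (cfc (fun t : ℝ => t ^ ((n : ℝ)⁻¹)) a)).re with hu
  set w : ℕ → ℝ := fun n => (τ (cfc (fun t : ℝ => (t / ‖a‖) ^ ((n : ℝ)⁻¹)) a)).re with hw
  have hcont (n : ℕ) : Continuous fun t : ℝ => (t / ‖a‖) ^ ((n : ℝ)⁻¹) :=
    continuous_rpow_inv_natCast.comp (by fun_prop)
  have hspec : ∀ t ∈ spectrum ℝ a, 0 ≤ t / ‖a‖ ∧ t / ‖a‖ ≤ 1 := fun t ht => by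
    have h0 : 0 ≤ t := spectrum_nonneg_of_nonneg ha ht
    have h1 : ‖t‖ ≤ ‖a‖ := spectrum.norm_le_norm_of_mem ht
    rw [Real.norm_of_nonneg h0] at h1
    exact ⟨by positivity, (div_le_one hC).mpr h1⟩
  have hmono : Monotone fun n => w (n + 1) := by
    intro m n hmn
    refine hτ.re_mono (cfc_mono (fun t ht => ?_) (hcont _).continuousOn (hcont _).continuousOn)
    obtain ⟨h0, h1⟩ := hspec t ht
    have hmn' : (((n + 1 : ℕ) : ℝ))⁻¹ ≤ (((m + 1 : ℕ) : ℝ))⁻¹ := by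
      gcongr
    rcases h0.eq_or_lt with h | h
    · rw [← h, Real.zero_rpow (by positivity), Real.zero_rpow (by positivity)]
    · exact Real.rpow_le_rpow_of_exponent_ge h h1 hmn'
  have hbdd : BddAbove (Set.range fun n => w (n + 1)) := by
    refine ⟨1, ?_⟩
    rintro _ ⟨n, rfl⟩
    have h := hτ.re_mono (cfc_le_one (fun t : ℝ => (t / ‖a‖) ^ (((n + 1 : ℕ) : ℝ)⁻¹)) a
      fun t ht => Real.rpow_le_one (hspec t ht).1 (hspec t ht).2 (by positivity))
    rw [hτ.2.1, Complex.one_re] at h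
    exact h
  have hlim : Tendsto w atTop (𝓝 _) :=
    (tendsto_add_atTop_iff_nat 1).mp (tendsto_atTop_ciSup hmono hbdd)
  have huw (n : ℕ) : u n = ‖a‖ ^ ((n : ℝ)⁻¹) * w n := by
    rw [hu, hw]
    dsimp only
    rw [← LinearMap.re_apply_real_smul, ← cfc_smul _ _ _ (hcont n).continuousOn]
    congr 2
    refine cfc_congr fun t ht => ?_
    rw [smul_eq_mul, ← Real.mul_rpow hC.le (hspec t ht).1, mul_div_cancel₀ _ hC.ne']
  exact ⟨_, ((tendsto_rpow_inv_natCast hC).mul hlim).congr fun n => (huw n).symm⟩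

theorem IsTracialState.re_cfc_ramp_le_dTr {τ : A →ₗ[ℂ] ℂ} (hτ : IsTracialState τ) {a : A}
    (ha : 0 ≤ a) (ha0 : a ≠ 0) {δ : ℝ} (hδ : 0 < δ) :
    (τ (cfc (ramp δ) a)).re ≤ dTr τ a := by
  have h := (tendsto_rpow_inv_natCast (inv_pos.mpr hδ)).mul (hτ.tendsto_dTr ha ha0)
  rw [one_mul] at h
  refine ge_of_tendsto h ?_
  filter_upwards [eventually_ne_atTop 0] with n hn
  rw [← LinearMap.re_apply_real_smul,
    ← cfc_smul _ _ _ continuous_rpow_inv_natCast.continuousOn]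
  refine hτ.re_mono (cfc_mono (fun t ht => ?_) (continuous_ramp δ).continuousOn
    (continuous_const.mul continuous_rpow_inv_natCast).continuousOn)
  exact ramp_le_rpow hδ (spectrum_nonneg_of_nonneg ha ht) hn

/-- If a projection `p` is Cuntz below `a`, then for small `ε` it is equivalent to a projection
in the corner cut out by the part of `a` above `ε`. -/
theorem CuntzLE.exists_isStarProjection {p a : A} (hp : IsStarProjection p) (ha : 0 ≤ a)
    (h : CuntzLE p a) :
    ∃ ε : ℝ, 0 < ε ∧ ∃ c z : A, IsStarProjection (star c * (z * c)) ∧ z * (c * star c) = p ∧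
      c * cfc (ramp ε) a = c := by
  obtain ⟨x, hx⟩ := h
  obtain ⟨N, hN⟩ := Metric.tendsto_atTop.mp hx (1 / 4) (by norm_num)
  have hN := hN N le_rfl
  rw [dist_eq_norm] at hN
  generalize x N = x at hN
  have hpn : ‖p‖ ≤ 1 := hp.norm_le
  set ε : ℝ := 1 / (4 * (‖x‖ ^ 2 + 1)) with hε
  have hε0 : 0 < ε := by positivity
  have hxε : ‖x‖ * ε * ‖x‖ ≤ 1 / 4 := by
    rw [hε]
    field_simp
    nlinarith
  have hsa : IsSelfAdjoint a := .of_nonneg ha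
  set s : A := cfc (fun t : ℝ => √(t - ε)) a with hs
  have hscont : Continuous fun t : ℝ => √(t - ε) := by fun_prop
  have hs_star : star s = s := (cfc_predicate (R := ℝ) _ a : IsSelfAdjoint s)
  have hss : ‖s * s - a‖ ≤ ε := by
    rw [hs, ← cfc_mul _ _ _ hscont.continuousOn hscont.continuousOn]
    conv_lhs => enter [1, 2]; rw [← cfc_id ℝ a]
    rw [← cfc_sub _ _ _ (by fun_prop) (by fun_prop)]
    refine norm_cfc_le hε0.le fun t ht => ?_
    have ht0 := spectrum_nonneg_of_nonneg ha ht
    rw [id, Real.norm_eq_abs, abs_le]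
    rcases le_total t ε with h | h
    · rw [Real.sqrt_eq_zero_of_nonpos (by linarith)]
      constructor <;> linarith
    · rw [Real.mul_self_sqrt (by linarith)]
      constructor <;> linarith
  have hse : s * cfc (ramp ε) a = s := by
    rw [hs, ← cfc_mul _ _ _ hscont.continuousOn (continuous_ramp ε).continuousOn]
    refine cfc_congr fun t ht => ?_
    rcases le_total t ε with h | h
    · simp [Real.sqrt_eq_zero_of_nonpos (sub_nonpos.mpr h)]
    · have : ramp ε t = 1 := min_eq_right ((one_le_div hε0).mpr h)
      simp [this]
  have hps : star p = p := hp.isSelfAdjoint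
  have hpp : p * p = p := hp.isIdempotentElem
  set c : A := p * x * s with hc
  set Y : A := 1 - p * (p - x * (s * s) * star x) * p with hY
  have hnorm : ‖p * (p - x * (s * s) * star x) * p‖ < 1 := by
    have h1 : ‖x * (s * s - a) * star x‖ ≤ 1 / 4 := by
      calc _ ≤ ‖x‖ * ‖s * s - a‖ * ‖star x‖ := norm_mul₃_le
        _ ≤ ‖x‖ * ε * ‖x‖ := by rw [norm_star]; gcongr
        _ ≤ _ := hxε
    have h2 : ‖p - x * (s * s) * star x‖ ≤ 1 / 2 := by
      have : p - x * (s * s) * star x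
          = -(x * (s * s - a) * star x + (x * a * star x - p)) := by noncomm_ring
      rw [this, norm_neg]
      exact (norm_add_le _ _).trans (by linarith)
    calc _ ≤ ‖p‖ * ‖p - x * (s * s) * star x‖ * ‖p‖ := norm_mul₃_le
      _ ≤ 1 * (1 / 2) * 1 := by gcongr
      _ < 1 := by norm_num
  have hunit : IsUnit Y := isUnit_one_sub_of_norm_lt_one hnorm
  have hcc : c * star c = p * (x * (s * s) * star x) * p := by
    simp only [hc, star_mul, hs_star, hps, mul_assoc]
  have hYp : Y * p = c * star c := by
    simp only [hcc, hY, sub_mul, mul_sub, one_mul, mul_assoc, hpp]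
    abel
  have hYs : star Y = Y := by
    simp only [hY, star_sub, star_mul, star_star, hs_star, hps, star_one, mul_assoc]
  have hpc : p * c = c := by simp only [hc, ← mul_assoc, hpp]
  have hce : c * cfc (ramp ε) a = c := by rw [hc, mul_assoc, hse]
  clear_value c Y
  obtain ⟨u, rfl⟩ := hunit
  have hz : (↑u⁻¹ : A) * (c * star c) = p := by rw [← hYp, Units.inv_mul_cancel_left]
  have hus : star (↑u⁻¹ : A) = ↑u⁻¹ := by
    have : star u = u := Units.ext (by simpa using hYs)
    rw [← Units.coe_star, star_inv, this]
  refine ⟨ε, hε0, c, ↑u⁻¹, ⟨?_, ?_⟩, hz, hce⟩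
  · have hcp : star c * p = star c := by
      conv_rhs => rw [← hpc, star_mul, hps]
    change star c * (↑u⁻¹ * c) * (star c * (↑u⁻¹ * c)) = _
    calc _ = star c * (↑u⁻¹ * (c * star c)) * (↑u⁻¹ * c) := by simp only [mul_assoc]
      _ = _ := by rw [hz, hcp]
  · change star _ = _
    simp only [star_mul, star_star, hus, mul_assoc]

theorem IsStarProjection.le_cfc_ramp {q a : A} (hq : IsStarProjection q) (ha : 0 ≤ a) {ε : ℝ}
    (hε : 0 < ε) (h : q * cfc (ramp ε) a = q) : q ≤ cfc (ramp ε) a := by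
  set e : A := cfc (ramp ε) a with he
  have hcont := (continuous_ramp ε).continuousOn (s := spectrum ℝ a)
  have hes : star e = e := (cfc_predicate (R := ℝ) _ a : IsSelfAdjoint e)
  have heq : e * q = q := by
    have := congrArg star h
    rwa [star_mul, hes, hq.isSelfAdjoint.star_eq] at this
  calc q = star e * q * e := by rw [hes, heq, h]
    _ ≤ star e * 1 * e := star_left_conjugate_le_conjugate hq.le_one e
    _ = cfc (fun t => ramp ε t * ramp ε t) a := by
      rw [mul_one, hes, he, cfc_mul _ _ _ hcont hcont]
    _ ≤ e := cfc_mono (fun t ht => ?_) (hcont.mul hcont) hcont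
  have h0 : 0 ≤ ramp ε t :=
    le_min (div_nonneg (spectrum_nonneg_of_nonneg ha ht) hε.le) zero_le_one
  exact mul_le_of_le_one_left h0 (min_le_right _ _)

/-- Under a faithful trace, cut-offs at different heights are distinguished as soon as `0` is a
non-isolated point of the spectrum. -/
theorem exists_re_cfc_ramp_lt {τ : A →ₗ[ℂ] ℂ}
    (hτ : ∀ x : A, 0 ≤ x → x ≠ 0 → 0 < τ x) {a : A} (ha : 0 ≤ a)
    (hacc : (0 : ℝ) ∈ closure (spectrum ℝ a \ {0})) {ε : ℝ} (hε : 0 < ε) :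
    ∃ δ : ℝ, 0 < δ ∧ (τ (cfc (ramp ε) a)).re < (τ (cfc (ramp δ) a)).re := by
  obtain ⟨t, ⟨ht, ht0⟩, htε⟩ := Metric.mem_closure_iff.mp hacc ε hε
  have htpos : 0 < t := (spectrum_nonneg_of_nonneg ha ht).lt_of_ne' ht0
  rw [dist_zero_left, Real.norm_of_nonneg htpos.le] at htε
  have hsa : IsSelfAdjoint a := .of_nonneg ha
  refine ⟨t, htpos, ?_⟩
  have hle : cfc (ramp ε) a ≤ cfc (ramp t) a := by
    refine cfc_mono (fun r hr => ?_) (continuous_ramp ε).continuousOn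
      (continuous_ramp t).continuousOn
    have := spectrum_nonneg_of_nonneg ha hr
    exact min_le_min_right _ (by gcongr)
  have hne : cfc (ramp t) a - cfc (ramp ε) a ≠ 0 := by
    rw [sub_ne_zero]
    intro h
    have := (cfc_eq_cfc_iff_eqOn hsa (continuous_ramp t).continuousOn
      (continuous_ramp ε).continuousOn).mp h ht
    have h1 : ramp t t = 1 := by simp [ramp, div_self htpos.ne']
    have h2 : ramp ε t < 1 := min_lt_iff.mpr (Or.inl ((div_lt_one hε).mpr htε))
    exact absurd this (h1 ▸ h2.ne')
  have h := (Complex.lt_def.mp (hτ _ (sub_nonneg.mpr hle) hne)).1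
  rw [map_sub] at h
  simpa using h

end

open scoped ComplexOrder in
/-- In a simple unital C*-algebra with tracial states, all faithful, and with strict comparison,
a nonzero projection `p` satisfies `p ≾ a` for a positive `a` whose spectrum contains `0` as a
non-isolated point if and only if `d_τ(p) < d_τ(a)` for every tracial state `τ`. -/
theorem projection_cuntzLE_iff_dTr_lt {A : Type*} [CStarAlgebra A] [PartialOrder A]
    [StarOrderedRing A]
    (hsimple : ∀ I : TwoSidedIdeal A, IsClosed (I : Set A) → I = ⊥ ∨ I = ⊤)
    (hexists : ∃ τ : A →ₗ[ℂ] ℂ, IsTracialState τ)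
    (hfaithful : ∀ τ : A →ₗ[ℂ] ℂ, IsTracialState τ → ∀ x : A, 0 ≤ x → x ≠ 0 → 0 < τ x)
    (hcomp : StrictComparison A)
    (p : A) (hp_star : star p = p) (hp_idem : p * p = p) (hp0 : p ≠ 0)
    (a : A) (ha : 0 ≤ a) (hacc : (0 : ℝ) ∈ closure (spectrum ℝ a \ {0})) :
    CuntzLE p a ↔ ∀ τ : A →ₗ[ℂ] ℂ, IsTracialState τ → dTr τ p < dTr τ a := by
  have hp : IsStarProjection p := ⟨hp_idem, hp_star⟩
  have ha0 : a ≠ 0 := by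
    rintro rfl
    obtain ⟨t, ht, ht0⟩ := closure_nonempty_iff.mp ⟨0, hacc⟩
    have := spectrum.norm_le_norm_mul_of_mem ht
    rw [norm_zero, zero_mul] at this
    exact ht0 (norm_le_zero_iff.mp this)
  refine ⟨fun h τ hτ => ?_, fun h => hcomp p a hp.nonneg ha hp0 ha0 h⟩
  obtain ⟨ε, hε, c, z, hq, hz, hc⟩ := h.exists_isStarProjection hp ha
  obtain ⟨δ, hδ, hlt⟩ := exists_re_cfc_ramp_lt (hfaithful τ hτ) ha hacc hε
  have htr : τ (star c * (z * c)) = τ p := by rw [hτ.2.2, mul_assoc, hz]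
  calc dTr τ p = (τ (star c * (z * c))).re := by rw [dTr_eq_of_isStarProjection τ hp, htr]
    _ ≤ (τ (cfc (ramp ε) a)).re := hτ.re_mono (hq.le_cfc_ramp ha hε (by simp only [mul_assoc, hc]))
    _ < (τ (cfc (ramp δ) a)).re := hlt
    _ ≤ dTr τ a := hτ.re_cfc_ramp_le_dTr ha ha0 hδ
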